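/- arXiv:1607.01686 — 6 statements merged into one kernel-verified Lean document; each statement's English description precedes it below -/
import Mathlib

section
/- The problem EXACTLY-ONE-ZERO for primitive recursive functions lies in Δ2 \ (Σ1 ∪ Π1), in the following uniform sense: (i) for every primitive recursive family F, the set {n : ℕ | ∃! y, F n y = 0} is both Σ2 and Π2; and (ii) there exists a primitive recursive family F such that neither the set {n : ℕ | ∃! y, F n y = 0} nor its complement is recursively enumerable. -/
def IsSigma2 (P : ℕ → Prop) : Prop :=
  ∃ R : ℕ → ℕ → ℕ → Bool,
    Computable (fun p : ℕ × ℕ × ℕ => R p.1 p.2.1 p.2.2) ∧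
    ∀ n, P n ↔ ∃ y, ∀ z, R n y z = true

def IsPi2 (P : ℕ → Prop) : Prop :=
  ∃ R : ℕ → ℕ → ℕ → Bool,
    Computable (fun p : ℕ × ℕ × ℕ => R p.1 p.2.1 p.2.2) ∧
    ∀ n, P n ↔ ∀ y, ∃ z, R n y z = true

open Nat.Partrec (Code)

/-- Recursive enumerability is preserved by computable preimages. -/
theorem REPred.comp_computable {α β : Type*} [Primcodable α] [Primcodable β] {p : β → Prop}
    (hp : REPred p) {f : α → β} (hf : Computable f) : REPred fun a => p (f a) :=
  Partrec.comp hp hf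

theorem isSigma2_existsUnique_zero {F : ℕ → ℕ → ℕ} (hF : Primrec₂ F) :
    IsSigma2 fun n => ∃! y, F n y = 0 := by
  refine ⟨fun n y z => decide (F n y = 0 ∧ (¬ F n z = 0 ∨ z = y)), ?_, fun n => ?_⟩
  · have hn : Primrec fun p : ℕ × ℕ × ℕ => p.1 := Primrec.fst
    have hy : Primrec fun p : ℕ × ℕ × ℕ => p.2.1 := Primrec.fst.comp Primrec.snd
    have hz : Primrec fun p : ℕ × ℕ × ℕ => p.2.2 := Primrec.snd.comp Primrec.snd
    have zeroAt {g : ℕ × ℕ × ℕ → ℕ} (hg : Primrec g) : PrimrecPred fun p => F p.1 (g p) = 0 :=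
      Primrec.eq.comp (hF.comp hn hg) (Primrec.const 0)
    exact ((zeroAt hy).and ((zeroAt hz).not.or (Primrec.eq.comp hz hy))).decide.to_comp
  · simp only [decide_eq_true_eq, forall_and, forall_const, ← imp_iff_not_or]
    rfl

theorem isPi2_existsUnique_zero {F : ℕ → ℕ → ℕ} (hF : Primrec₂ F) :
    IsPi2 fun n => ∃! y, F n y = 0 := by
  refine ⟨fun n y z => decide (F n z = 0 ∧
    (¬ (F n y.unpair.1 = 0 ∧ F n y.unpair.2 = 0) ∨ y.unpair.1 = y.unpair.2)), ?_, fun n => ?_⟩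
  · have hn : Primrec fun p : ℕ × ℕ × ℕ => p.1 := Primrec.fst
    have hy : Primrec fun p : ℕ × ℕ × ℕ => p.2.1.unpair :=
      Primrec.unpair.comp (Primrec.fst.comp Primrec.snd)
    have hz : Primrec fun p : ℕ × ℕ × ℕ => p.2.2 := Primrec.snd.comp Primrec.snd
    have hy₁ := Primrec.fst.comp hy
    have hy₂ := Primrec.snd.comp hy
    have zeroAt {g : ℕ × ℕ × ℕ → ℕ} (hg : Primrec g) : PrimrecPred fun p => F p.1 (g p) = 0 :=
      Primrec.eq.comp (hF.comp hn hg) (Primrec.const 0)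
    exact ((zeroAt hz).and (((zeroAt hy₁).and (zeroAt hy₂)).not.or
      (Primrec.eq.comp hy₁ hy₂))).decide.to_comp
  · simp only [decide_eq_true_eq, ← imp_iff_not_or]
    constructor
    · rintro ⟨z, hz, huniq⟩ y
      exact ⟨z, hz, fun h => (huniq _ h.1).trans (huniq _ h.2).symm⟩
    · intro h
      obtain ⟨z, hz, -⟩ := h 0
      refine ⟨z, hz, fun w hw => ?_⟩
      obtain ⟨-, -, heq⟩ := h (Nat.pair w z)
      simpa [hz, hw] using heq

/-- The code `c` halts on input `0` within `k` steps. -/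
def haltsWithin (k : ℕ) (c : Code) : Bool := (Code.evaln k c 0).isSome

theorem haltsWithin_zero (c : Code) : haltsWithin 0 c = false := by
  simp [haltsWithin, Code.evaln]

theorem haltsWithin_mono {k l : ℕ} {c : Code} (hkl : k ≤ l) (h : haltsWithin k c = true) :
    haltsWithin l c = true := by
  obtain ⟨x, hx⟩ := Option.isSome_iff_exists.1 h
  exact Option.isSome_iff_exists.2 ⟨x, Code.evaln_mono hkl hx⟩

theorem eval_zero_dom_iff_exists_haltsWithin (c : Code) :
    (Code.eval c 0).Dom ↔ ∃ k, haltsWithin k c = true := by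
  simp only [Part.dom_iff_mem, Code.evaln_complete, haltsWithin, Option.isSome_iff_exists,
    Option.mem_def]
  exact exists_comm

theorem primrec_haltsWithin : Primrec₂ haltsWithin :=
  Primrec.option_isSome.comp (Code.primrec_evaln.comp (Primrec.pair Primrec.id (Primrec.const 0)))

theorem existsUnique_first_haltsWithin_iff (c : Code) :
    (∃! y, haltsWithin (y + 1) c = true ∧ haltsWithin y c = false) ↔ (Code.eval c 0).Dom := by
  rw [eval_zero_dom_iff_exists_haltsWithin]
  constructor
  · rintro ⟨y, hy, -⟩
    exact ⟨_, hy.1⟩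
  · intro h
    obtain ⟨m, hm⟩ : ∃ m, Nat.find h = m + 1 := Nat.exists_eq_succ_of_ne_zero fun h0 => by
      simpa [h0, haltsWithin_zero] using Nat.find_spec h
    refine ⟨m, ⟨hm ▸ Nat.find_spec h, ?_⟩, fun y hy => ?_⟩
    · simpa using Nat.find_min h (m := m) (by omega)
    · have hle : Nat.find h ≤ y + 1 := Nat.find_min' h hy.1
      by_contra hne
      have := haltsWithin_mono (show Nat.find h ≤ y by omega) (Nat.find_spec h)
      simp [hy.2] at this

theorem existsUnique_eq_zero_or_haltsWithin_iff (c : Code) :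
    (∃! y, y = 0 ∨ haltsWithin y c = true) ↔ ¬ (Code.eval c 0).Dom := by
  rw [eval_zero_dom_iff_exists_haltsWithin]
  constructor
  · rintro ⟨y, -, huniq⟩ ⟨k, hk⟩
    have : k = 0 := (huniq k (.inr hk)).trans (huniq 0 (.inl rfl)).symm
    simp [this, haltsWithin_zero] at hk
  · intro h
    exact ⟨0, .inl rfl, fun y hy => hy.resolve_right fun hk => h ⟨y, hk⟩⟩

/-- For `n = 2 * e`, the unique possible zero is the last stage before the code `e` halts; for
`n = 2 * e + 1`, the zeros are `0` and the stages by which `e` has halted. -/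
def haltingFamily (n y : ℕ) : ℕ :=
  if n.bodd = true then
    if y = 0 ∨ haltsWithin y (Denumerable.ofNat Code n.div2) = true then 0 else 1
  else
    if haltsWithin (y + 1) (Denumerable.ofNat Code n.div2) = true ∧
      haltsWithin y (Denumerable.ofNat Code n.div2) = false then 0 else 1

theorem primrec_haltingFamily : Primrec₂ haltingFamily := by
  have hc : Primrec fun p : ℕ × ℕ => Denumerable.ofNat Code p.1.div2 :=
    (Primrec.ofNat Code).comp (Primrec.nat_div2.comp Primrec.fst)
  have halts {g : ℕ × ℕ → ℕ} (hg : Primrec g) (b : Bool) :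
      PrimrecPred fun p => haltsWithin (g p) (Denumerable.ofNat Code p.1.div2) = b :=
    Primrec.eq.comp (primrec_haltsWithin.comp hg hc) (Primrec.const b)
  exact Primrec.ite
    (Primrec.eq.comp (Primrec.nat_bodd.comp Primrec.fst) (Primrec.const true))
    (Primrec.ite ((Primrec.eq.comp Primrec.snd (Primrec.const 0)).or (halts Primrec.snd true))
      (Primrec.const 0) (Primrec.const 1))
    (Primrec.ite ((halts (Primrec.succ.comp Primrec.snd) true).and (halts Primrec.snd false))
      (Primrec.const 0) (Primrec.const 1))

theorem existsUnique_haltingFamily_even (c : Code) :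
    (∃! y, haltingFamily (2 * Encodable.encode c) y = 0) ↔ (Code.eval c 0).Dom := by
  rw [← existsUnique_first_haltsWithin_iff]
  simp [haltingFamily]

theorem existsUnique_haltingFamily_odd (c : Code) :
    (∃! y, haltingFamily (2 * Encodable.encode c + 1) y = 0) ↔ ¬ (Code.eval c 0).Dom := by
  rw [← existsUnique_eq_zero_or_haltsWithin_iff]
  simp [haltingFamily, or_iff_not_imp_left]

theorem exactlyOneZero_Delta2_minus_Sigma1_union_Pi1 :
    (∀ F : ℕ → ℕ → ℕ, Primrec₂ F →
      IsSigma2 (fun n => ∃! y, F n y = 0) ∧ IsPi2 (fun n => ∃! y, F n y = 0)) ∧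
    (∃ F : ℕ → ℕ → ℕ, Primrec₂ F ∧
      ¬ REPred (fun n => ∃! y, F n y = 0) ∧
      ¬ REPred (fun n => ¬ ∃! y, F n y = 0)) := by
  have hEven : Primrec fun c : Code => 2 * Encodable.encode c :=
    Primrec.nat_mul.comp (Primrec.const 2) Primrec.encode
  refine ⟨fun F hF => ⟨isSigma2_existsUnique_zero hF, isPi2_existsUnique_zero hF⟩,
    haltingFamily, primrec_haltingFamily, fun h => ?_, fun h => ?_⟩
  · exact ComputablePred.halting_problem_not_re 0
      ((h.comp_computable (Primrec.succ.comp hEven).to_comp).of_eq existsUnique_haltingFamily_odd)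
  · exact ComputablePred.halting_problem_not_re 0
      ((h.comp_computable hEven.to_comp).of_eq fun c =>
        not_congr (existsUnique_haltingFamily_even c))
end

section
/- For every fixed k ≥ 1, the problem EXACTLY-k-ZEROS for primitive recursive functions lies in Δ2 \ (Σ1 ∪ Π1), in the following uniform sense: (i) for every primitive recursive family F, the set {n : ℕ | the set {y | F n y = 0} has exactly k elements} is both Σ2 and Π2; and (ii) there exists a primitive recursive family F such that neither this set nor its complement is recursively enumerable. -/
open Nat.Partrec (Code)

theorem Primrec₂.count_zeros {F : ℕ → ℕ → ℕ} (hF : Primrec₂ F) :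
    Primrec₂ fun n m => Nat.count (fun y => F n y = 0) m := by
  have hstep : Primrec₂ fun (n : ℕ) (p : ℕ × ℕ) => if F n p.1 = 0 then p.2 + 1 else p.2 :=
    Primrec.ite
      (Primrec.eq.comp (hF.comp .fst (Primrec.fst.comp .snd)) (.const 0))
      (Primrec.succ.comp (Primrec.snd.comp .snd)) (Primrec.snd.comp .snd)
  refine (Primrec.nat_rec (Primrec.const 0) hstep).of_eq fun n m => ?_
  induction m with
  | zero => simp
  | succ m ih =>
    simp only [Nat.count_succ, ← ih]
    split_ifs <;> rfl

theorem exists_finset_card_eq_iff_count {p : ℕ → Prop} [DecidablePred p] {k : ℕ} :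
    (∃ T : Finset ℕ, T.card = k ∧ ∀ y, (p y ↔ y ∈ T)) ↔
      (∃ m, k ≤ Nat.count p m) ∧ ∀ m, Nat.count p m ≤ k := by
  constructor
  · rintro ⟨T, rfl, hT⟩
    refine ⟨⟨T.sup id + 1, ?_⟩, fun m => ?_⟩ <;> rw [Nat.count_eq_card_filter_range]
    · refine Finset.card_le_card fun y hy => ?_
      simpa [hT, hy, Nat.lt_succ_iff] using Finset.le_sup (f := id) hy
    · exact Finset.card_le_card fun y hy => (hT y).1 (Finset.mem_filter.1 hy).2
  · rintro ⟨⟨m, hm⟩, hle⟩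
    refine ⟨{y ∈ Finset.range m | p y}, ?_, fun y => ?_⟩
    · rw [← Nat.count_eq_card_filter_range]
      exact le_antisymm (hle m) hm
    · simp only [Finset.mem_filter, Finset.mem_range]
      refine ⟨fun hy => ⟨?_, hy⟩, And.right⟩
      by_contra! hmy
      have hmono := Nat.count_monotone p hmy
      have hsucc := hle (y + 1)
      rw [Nat.count_succ, if_pos hy] at hsucc
      omega

theorem isSigma2_and_isPi2_exactly_zeros (k : ℕ) {F : ℕ → ℕ → ℕ} (hF : Primrec₂ F) :
    IsSigma2 (fun n => ∃ T : Finset ℕ, T.card = k ∧ ∀ y, (F n y = 0 ↔ y ∈ T)) ∧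
      IsPi2 (fun n => ∃ T : Finset ℕ, T.card = k ∧ ∀ y, (F n y = 0 ↔ y ∈ T)) := by
  have hy : Primrec fun p : ℕ × ℕ × ℕ => Nat.count (fun y => F p.1 y = 0) p.2.1 :=
    hF.count_zeros.comp .fst (Primrec.fst.comp .snd)
  have hz : Primrec fun p : ℕ × ℕ × ℕ => Nat.count (fun y => F p.1 y = 0) p.2.2 :=
    hF.count_zeros.comp .fst (Primrec.snd.comp .snd)
  constructor
  · refine ⟨fun n y z => decide (k ≤ Nat.count (fun y => F n y = 0) y ∧
      Nat.count (fun y => F n y = 0) z ≤ k), ?_, fun n => ?_⟩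
    · exact (((Primrec.nat_le.comp (.const k) hy).and
        (Primrec.nat_le.comp hz (.const k))).decide).to_comp
    · simp [exists_finset_card_eq_iff_count, forall_and]
  · refine ⟨fun n y z => decide (Nat.count (fun y => F n y = 0) y ≤ k ∧
      k ≤ Nat.count (fun y => F n y = 0) z), ?_, fun n => ?_⟩
    · exact (((Primrec.nat_le.comp hy (.const k)).and
        (Primrec.nat_le.comp (.const k) hz)).decide).to_comp
    · simp [exists_finset_card_eq_iff_count, forall_and, and_comm]

/-- The code `c` halts on input `0` within `s + 1` steps but not within `s` steps. -/
def HaltsExactlyAt (c : Code) (s : ℕ) : Prop :=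
  (Code.evaln (s + 1) c 0).isSome = true ∧ (Code.evaln s c 0).isSome = false

instance (c : Code) : DecidablePred (HaltsExactlyAt c) :=
  fun _ => inferInstanceAs (Decidable (_ ∧ _))

theorem primrecRel_haltsExactlyAt : PrimrecRel HaltsExactlyAt := by
  have hs : Primrec₂ fun (c : Code) (s : ℕ) => (Code.evaln s c 0).isSome :=
    Primrec.option_isSome.comp
      (Code.primrec_evaln.comp (Primrec.pair (Primrec.pair .snd .fst) (.const 0)))
  exact (Primrec.eq.comp (hs.comp .fst (Primrec.succ.comp .snd)) (.const true)).and
    (Primrec.eq.comp (hs.comp .fst .snd) (.const false))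

theorem isSome_evaln_mono {c : Code} {n s t : ℕ} (hst : s ≤ t)
    (h : (Code.evaln s c n).isSome = true) : (Code.evaln t c n).isSome = true := by
  obtain ⟨x, hx⟩ := Option.isSome_iff_exists.1 h
  exact Option.isSome_iff_exists.2 ⟨x, Code.evaln_mono hst hx⟩

theorem HaltsExactlyAt.unique {c : Code} {s t : ℕ} (hs : HaltsExactlyAt c s)
    (ht : HaltsExactlyAt c t) : s = t := by
  by_contra hne
  rcases Nat.lt_or_gt_of_ne hne with h | h
  · simpa [ht.2] using isSome_evaln_mono h hs.1
  · simpa [hs.2] using isSome_evaln_mono h ht.1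

theorem exists_haltsExactlyAt_iff {c : Code} :
    (∃ s, HaltsExactlyAt c s) ↔ (Code.eval c 0).Dom := by
  constructor
  · rintro ⟨s, hs, -⟩
    obtain ⟨x, hx⟩ := Option.isSome_iff_exists.1 hs
    exact Part.dom_iff_mem.2 ⟨x, Code.evaln_sound hx⟩
  · intro h
    obtain ⟨x, hx⟩ := Part.dom_iff_mem.1 h
    obtain ⟨t, ht⟩ := Code.evaln_complete.1 hx
    by_contra! hall
    have hnone (s : ℕ) : (Code.evaln s c 0).isSome = false := by
      induction s with
      | zero => simp [Code.evaln]
      | succ s ih => exact Bool.eq_false_iff.2 fun hs => hall s ⟨hs, ih⟩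
    have hsome := Option.isSome_iff_exists.2 ⟨x, ht⟩
    simp [hnone t] at hsome

/-- For `n` coding the pair of `i` and a code `c`, the zeros of `haltingZeros b n` are the numbers
below `b + i`, and one further number if `c` halts on input `0`. -/
def haltingZeros (b n y : ℕ) : ℕ :=
  if y < b + n.unpair.1 ∨ HaltsExactlyAt (Denumerable.ofNat Code n.unpair.2) (y - (b + n.unpair.1))
  then 0 else 1

theorem primrec_haltingZeros (b : ℕ) : Primrec₂ (haltingZeros b) := by
  have hn : Primrec fun p : ℕ × ℕ => p.1.unpair := Primrec.unpair.comp .fst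
  have hb : Primrec fun p : ℕ × ℕ => b + p.1.unpair.1 :=
    Primrec.nat_add.comp (.const b) (Primrec.fst.comp hn)
  have hc : Primrec fun p : ℕ × ℕ => Denumerable.ofNat Code p.1.unpair.2 :=
    (Primrec.ofNat Code).comp (Primrec.snd.comp hn)
  exact Primrec.ite ((Primrec.nat_lt.comp .snd hb).or
    (primrecRel_haltsExactlyAt.comp hc (Primrec.nat_sub.comp .snd hb))) (.const 0) (.const 1)

theorem exactly_zeros_haltingZeros_iff {k b i : ℕ} {c : Code} :
    (∃ T : Finset ℕ, T.card = k ∧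
      ∀ y, (haltingZeros b (Nat.pair i (Encodable.encode c)) y = 0 ↔ y ∈ T)) ↔
      (Code.eval c 0).Dom ∧ k = b + i + 1 ∨ ¬ (Code.eval c 0).Dom ∧ k = b + i := by
  have hzero (y : ℕ) : haltingZeros b (Nat.pair i (Encodable.encode c)) y = 0 ↔
      y < b + i ∨ HaltsExactlyAt c (y - (b + i)) := by
    simp only [haltingZeros, Nat.unpair_pair, Denumerable.ofNat_encode]
    split_ifs with h <;> simp [h]
  have heq (T T' : Finset ℕ)
      (h : ∀ y, (haltingZeros b (Nat.pair i (Encodable.encode c)) y = 0 ↔ y ∈ T))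
      (h' : ∀ y, (haltingZeros b (Nat.pair i (Encodable.encode c)) y = 0 ↔ y ∈ T')) : T = T' :=
    Finset.ext fun y => (h y).symm.trans (h' y)
  by_cases hdom : (Code.eval c 0).Dom
  · obtain ⟨s, hs⟩ := exists_haltsExactlyAt_iff.2 hdom
    have hT (y : ℕ) : haltingZeros b (Nat.pair i (Encodable.encode c)) y = 0 ↔
        y ∈ insert (b + i + s) (Finset.range (b + i)) := by
      rw [hzero, Finset.mem_insert, Finset.mem_range]
      constructor
      · rintro (h | h)
        · exact .inr h
        · have := h.unique hs
          omega
      · rintro (rfl | h)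
        · exact .inr (by simpa using hs)
        · exact .inl h
    have hcard : (insert (b + i + s) (Finset.range (b + i))).card = b + i + 1 := by
      rw [Finset.card_insert_of_notMem (by simp), Finset.card_range]
    simp only [hdom, true_and, not_true_eq_false, false_and, or_false]
    exact ⟨fun ⟨T, hk, h⟩ => by rw [← hk, heq T _ h hT, hcard],
      fun hk => ⟨_, hcard.trans hk.symm, hT⟩⟩
  · have hT (y : ℕ) : haltingZeros b (Nat.pair i (Encodable.encode c)) y = 0 ↔
        y ∈ Finset.range (b + i) := by
      rw [hzero, Finset.mem_range, or_iff_left]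
      exact fun h => hdom (exists_haltsExactlyAt_iff.1 ⟨_, h⟩)
    simp only [hdom, false_and, not_false_eq_true, true_and, false_or]
    exact ⟨fun ⟨T, hk, h⟩ => by rw [← hk, heq T _ h hT, Finset.card_range],
      fun hk => ⟨_, (Finset.card_range _).trans hk.symm, hT⟩⟩

theorem exactlyKZeros_Delta2_minus_Sigma1_union_Pi1 (k : ℕ) (hk : 1 ≤ k) :
    (∀ F : ℕ → ℕ → ℕ, Primrec₂ F →
      IsSigma2 (fun n => ∃ T : Finset ℕ, T.card = k ∧ ∀ y, (F n y = 0 ↔ y ∈ T)) ∧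
      IsPi2 (fun n => ∃ T : Finset ℕ, T.card = k ∧ ∀ y, (F n y = 0 ↔ y ∈ T))) ∧
    (∃ F : ℕ → ℕ → ℕ, Primrec₂ F ∧
      ¬ REPred (fun n => ∃ T : Finset ℕ, T.card = k ∧ ∀ y, (F n y = 0 ↔ y ∈ T)) ∧
      ¬ REPred (fun n => ¬ ∃ T : Finset ℕ, T.card = k ∧ ∀ y, (F n y = 0 ↔ y ∈ T))) := by
  have hpair (i : ℕ) : Computable fun c : Code => Nat.pair i (Encodable.encode c) :=
    (Primrec₂.natPair.comp (.const i) Primrec.encode).to_comp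
  refine ⟨fun F => isSigma2_and_isPi2_exactly_zeros k,
    haltingZeros (k - 1), primrec_haltingZeros (k - 1), fun h => ?_, fun h => ?_⟩
  · refine ComputablePred.halting_problem_not_re 0
      (REPred.of_eq (h.comp_computable (hpair 1)) fun c => ?_)
    rw [exactly_zeros_haltingZeros_iff]
    grind
  · refine ComputablePred.halting_problem_not_re 0
      (REPred.of_eq (h.comp_computable (hpair 0)) fun c => ?_)
    rw [exactly_zeros_haltingZeros_iff]
    grind
end

section
/- The problem ZERO-FUNCTION for primitive recursive functions is Π1-complete, in the following uniform sense: (i) for every primitive recursive family F, the set {n : ℕ | ∀ y, F n y = 0} is Π1; and (ii) there exists a primitive recursive family F such that the set {n : ℕ | ∀ y, F n y = 0} is Π1-complete, i.e. every Π1 subset of ℕ many-one reduces to it. -/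
def Pi1 (P : ℕ → Prop) : Prop := REPred fun n => ¬ P n

def Pi1Complete (Q : ℕ → Prop) : Prop :=
  Pi1 Q ∧ ∀ P : ℕ → Prop, Pi1 P → ManyOneReducible P Q

open Nat.Partrec Nat.Partrec.Code

/-- The zero set of a primitive recursive family is `Π₁`: unbounded search for a nonzero value
halts exactly on its complement. -/
theorem pi1_forall_eq_zero {F : ℕ → ℕ → ℕ} (hF : Primrec₂ F) : Pi1 fun n => ∀ y, F n y = 0 := by
  have hp : Computable₂ fun n y => decide (F n y ≠ 0) :=
    (Primrec.not.comp (Primrec.beq.comp hF (Primrec.const 0))).to_comp.of_eq fun p => by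
      rw [Bool.eq_iff_iff]; simp
  refine (Partrec.rfind hp.partrec₂).dom_re.of_eq fun n => ?_
  rw [Nat.rfind_dom]
  simp

/-- An r.e. predicate on `ℕ` is the domain of the partial function computed by some code. -/
theorem REPred.exists_code {p : ℕ → Prop} (hp : REPred p) :
    ∃ c : Code, ∀ n, (eval c n).Dom ↔ p n := by
  have hf : Partrec fun n => (Part.assert (p n) fun _ => Part.some ()).map fun _ => (0 : ℕ) :=
    hp.map (Computable.const 0).to₂
  obtain ⟨c, hc⟩ := Code.exists_code.1 (Partrec.nat_iff.1 hf)
  exact ⟨c, fun n => by simp [hc, Part.assert]⟩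

/-- At index `⟨e, x⟩` and argument `k`, the encoded result of running the code numbered `e` on
input `x` with bound `k`; the value is `0` exactly when no result is found. -/
def boundedEvalFamily (n k : ℕ) : ℕ :=
  Encodable.encode (evaln k (Denumerable.ofNat Code n.unpair.1) n.unpair.2)

theorem primrec₂_boundedEvalFamily : Primrec₂ boundedEvalFamily :=
  Primrec.encode.comp <| primrec_evaln.comp <|
    (Primrec.snd.pair ((Primrec.ofNat Code).comp
      (Primrec.fst.comp (Primrec.unpair.comp Primrec.fst)))).pair
    (Primrec.snd.comp (Primrec.unpair.comp Primrec.fst))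

theorem forall_boundedEvalFamily_eq_zero_iff (c : Code) (n : ℕ) :
    (∀ k, boundedEvalFamily (Nat.pair (Encodable.encode c) n) k = 0) ↔ ¬ (eval c n).Dom := by
  have key : (eval c n).Dom ↔ ∃ k, ∃ x, x ∈ evaln k c n := by
    simp_rw [Part.dom_iff_mem, evaln_complete]
    exact exists_comm
  rw [key, not_exists]
  refine forall_congr' fun k => ?_
  cases h : evaln k c n <;> simp [boundedEvalFamily, h]

theorem zeroFunction_Pi1_complete :
    (∀ F : ℕ → ℕ → ℕ, Primrec₂ F → Pi1 fun n => ∀ y, F n y = 0) ∧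
    (∃ F : ℕ → ℕ → ℕ, Primrec₂ F ∧
      Pi1Complete fun n => ∀ y, F n y = 0) := by
  refine ⟨fun F => pi1_forall_eq_zero, boundedEvalFamily, primrec₂_boundedEvalFamily,
    pi1_forall_eq_zero primrec₂_boundedEvalFamily, fun P hP => ?_⟩
  obtain ⟨c, hc⟩ := REPred.exists_code hP
  refine ⟨fun n => Nat.pair (Encodable.encode c) n,
    (Primrec₂.natPair.comp (Primrec.const _) Primrec.id).to_comp, fun n => ?_⟩
  simp only [forall_boundedEvalFamily_eq_zero_iff, hc, not_not]
end

section
/- The problem EQUIVALENCE for pairs of primitive recursive functions is Π1-complete, in the following uniform sense: (i) for every pair of primitive recursive families F and G, the set {n : ℕ | ∀ y, F n y = G n y} is Π1; and (ii) there exist primitive recursive families F and G such that the set {n : ℕ | ∀ y, F n y = G n y} is Π1-complete, i.e. every Π1 subset of ℕ many-one reduces to it. -/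
open Nat.Partrec in
/-- `y` steps of the computation coded by `n`, a pair of a program and an input; the value is `0`
exactly when no output has been produced yet. -/
def stepOutput (n y : ℕ) : ℕ :=
  Encodable.encode (Code.evaln y (Denumerable.ofNat Code n.unpair.1) n.unpair.2)

open Nat.Partrec in
theorem primrec₂_stepOutput : Primrec₂ stepOutput := by
  refine Primrec.encode.comp (Code.primrec_evaln.comp (.pair (.pair .snd ?_) ?_))
  · exact (Primrec.ofNat Code).comp (Primrec.fst.comp (Primrec.unpair.comp .fst))
  · exact Primrec.snd.comp (Primrec.unpair.comp .fst)

open Nat.Partrec in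
theorem forall_stepOutput_eq_zero_iff (c : Code) (n : ℕ) :
    (∀ y, stepOutput (Nat.pair (Encodable.encode c) n) y = 0) ↔ ¬ (c.eval n).Dom := by
  have encode_eq_zero (o : Option ℕ) : Encodable.encode o = 0 ↔ o = Option.none := by
    cases o <;> simp
  simp only [stepOutput, Nat.unpair_pair, Denumerable.ofNat_encode, encode_eq_zero,
    Part.dom_iff_mem, Code.evaln_complete, Option.eq_none_iff_forall_not_mem]
  grind

theorem pi1_forall_eq {F G : ℕ → ℕ → ℕ} (hF : Primrec₂ F) (hG : Primrec₂ G) :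
    Pi1 fun n => ∀ y, F n y = G n y := by
  have hne : Computable₂ fun n y => !decide (F n y = G n y) :=
    (Primrec.not.comp (Primrec.eq.decide.comp hF hG)).to_comp
  refine (Partrec.rfind hne.partrec₂).dom_re.of_eq fun n => ?_
  simp

theorem Pi1.exists_code {P : ℕ → Prop} (hP : Pi1 P) :
    ∃ c : Nat.Partrec.Code, ∀ n, P n ↔ ¬ (c.eval n).Dom := by
  have hpart : Partrec fun n => (Part.assert (¬ P n) fun _ => Part.some ()).map fun _ => 0 :=
    Partrec.map hP (Computable.const 0).to₂
  obtain ⟨c, hc⟩ := Nat.Partrec.Code.exists_code.1 (Partrec.nat_iff.1 hpart)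
  refine ⟨c, fun n => ?_⟩
  simp [hc, Part.assert]

theorem equivalence_Pi1_complete :
    (∀ F G : ℕ → ℕ → ℕ, Primrec₂ F → Primrec₂ G →
      Pi1 fun n => ∀ y, F n y = G n y) ∧
    (∃ F G : ℕ → ℕ → ℕ, Primrec₂ F ∧ Primrec₂ G ∧
      Pi1Complete fun n => ∀ y, F n y = G n y) := by
  refine ⟨fun F G hF hG => pi1_forall_eq hF hG, stepOutput, fun _ _ => 0, primrec₂_stepOutput,
    Primrec₂.const 0, pi1_forall_eq primrec₂_stepOutput (Primrec₂.const 0), fun P hP => ?_⟩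
  obtain ⟨c, hc⟩ := hP.exists_code
  refine ⟨fun n => Nat.pair (Encodable.encode c) n,
    (Primrec₂.natPair.comp (Primrec.const _) Primrec.id).to_comp, fun n => ?_⟩
  exact (hc n).trans (forall_stepOutput_eq_zero_iff c n).symm
end

section
/- The problem |CODOMAIN| = 1 for primitive recursive functions is Π1-complete, in the following uniform sense: (i) for every primitive recursive family F, the set {n : ℕ | the range of F n is a singleton, i.e. ∀ y, F n y = F n 0} is Π1; and (ii) there exists a primitive recursive family F such that this set is Π1-complete, i.e. every Π1 subset of ℕ many-one reduces to it. -/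
open Nat.Partrec (Code)

/-- Constancy of the sections of a primitive recursive family is a `Π₁` property of the index. -/
theorem pi1_constant_section (F : ℕ → ℕ → ℕ) (hF : Primrec₂ F) :
    Pi1 fun n => ∀ y, F n y = F n 0 := by
  have hdiff : Primrec₂ fun n y => !decide (F n y = F n 0) :=
    Primrec.not.comp <| (Primrec.eq (α := ℕ)).decide.comp hF
      (hF.comp Primrec.fst (Primrec.const 0))
  refine (Partrec.rfind hdiff.to_comp.partrec₂).dom_re.of_eq fun n => ?_
  rw [Nat.rfind_dom']
  simp

/-- The `y`-step evaluation of the code and input packed in `n`, encoded as a number that is `0`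
exactly when the computation has not yet halted. -/
def stepEval (n y : ℕ) : ℕ :=
  Encodable.encode (Code.evaln y (Denumerable.ofNat Code n.unpair.1) n.unpair.2)

theorem primrec₂_stepEval : Primrec₂ stepEval :=
  Primrec.encode.comp <| Code.primrec_evaln.comp <|
    (Primrec.snd.pair <| (Primrec.ofNat Code).comp <|
      Primrec.fst.comp <| Primrec.unpair.comp Primrec.fst).pair <|
    Primrec.snd.comp <| Primrec.unpair.comp Primrec.fst

theorem stepEval_constant_iff (c : Code) (m : ℕ) :
    (∀ y, stepEval (Nat.pair (Encodable.encode c) m) y =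
      stepEval (Nat.pair (Encodable.encode c) m) 0) ↔ ¬ (c.eval m).Dom := by
  have hzero : ∀ o : Option ℕ, Encodable.encode o = 0 ↔ o = none := by
    rintro (_ | a) <;> simp
  simp only [stepEval, Nat.unpair_pair, Denumerable.ofNat_encode, Code.evaln, Encodable.encode_none,
    hzero, Part.dom_iff_mem, Code.evaln_complete, Option.eq_none_iff_forall_not_mem]
  push Not
  exact forall_comm

/-- Every recursively enumerable set of naturals is the domain of a code. -/
theorem REPred.exists_code_dom {p : ℕ → Prop} (hp : REPred p) :
    ∃ c : Code, ∀ n, (c.eval n).Dom ↔ p n := by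
  have hpart : Partrec fun n => (Part.assert (p n) fun _ => Part.some ()).map fun _ => (0 : ℕ) :=
    Partrec.map hp (Computable.const 0).to₂
  obtain ⟨c, hc⟩ := Code.exists_code.1 (Partrec.nat_iff.1 hpart)
  exact ⟨c, fun n => by simp [hc, Part.assert]⟩

theorem codomainOne_Pi1_complete :
    (∀ F : ℕ → ℕ → ℕ, Primrec₂ F → Pi1 fun n => ∀ y, F n y = F n 0) ∧
    (∃ F : ℕ → ℕ → ℕ, Primrec₂ F ∧
      Pi1Complete fun n => ∀ y, F n y = F n 0) := by
  refine ⟨pi1_constant_section, stepEval, primrec₂_stepEval,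
    pi1_constant_section _ primrec₂_stepEval, fun P hP => ?_⟩
  obtain ⟨c, hc⟩ := REPred.exists_code_dom hP
  refine ⟨fun n => Nat.pair (Encodable.encode c) n,
    (Primrec₂.natPair.comp (Primrec.const _) Primrec.id).to_comp, fun n => ?_⟩
  beta_reduce
  rw [stepEval_constant_iff, hc, not_not]
end

section
/- For every fixed k ≥ 2, the problem |CODOMAIN| = k for primitive recursive functions lies in Δ2 \ (Σ1 ∪ Π1), in the following uniform sense: (i) for every primitive recursive family F, the set {n : ℕ | the range of F n has exactly k elements} is both Σ2 and Π2; and (ii) there exists a primitive recursive family F such that neither this set nor its complement is recursively enumerable. -/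
open Nat.Partrec (Code)

namespace CodomainCard

/-- The number of distinct values among `f 0, …, f (N - 1)`. -/
def valueCount (f : ℕ → ℕ) (N : ℕ) : ℕ :=
  N.rec 0 fun M c => if ∃ i < M, f i = f M then c else c + 1

theorem valueCount_eq_card (f : ℕ → ℕ) (N : ℕ) :
    valueCount f N = ((Finset.range N).image f).card := by
  induction N with
  | zero => rfl
  | succ M ih =>
    have step : valueCount f (M + 1) =
        if ∃ i < M, f i = f M then valueCount f M else valueCount f M + 1 := rfl
    have mem : f M ∈ (Finset.range M).image f ↔ ∃ i < M, f i = f M := by simp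
    rw [step, Finset.range_add_one, Finset.image_insert, ih, Finset.card_insert_eq_ite]
    simp only [mem]

theorem primrec_valueCount {F : ℕ → ℕ → ℕ} (hF : Primrec₂ F) :
    Primrec₂ fun n N => valueCount (F n) N := by
  have hrel : PrimrecRel fun (i : ℕ) (q : ℕ × ℕ × ℕ) => F q.1 i = F q.1 q.2.1 :=
    Primrec.eq.comp
      (hF.comp (Primrec.fst.comp Primrec.snd) Primrec.fst)
      (hF.comp (Primrec.fst.comp Primrec.snd)
        (Primrec.fst.comp (Primrec.snd.comp Primrec.snd)))
  have hex : PrimrecPred fun q : ℕ × ℕ × ℕ => ∃ i < q.2.1, F q.1 i = F q.1 q.2.1 :=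
    (hrel.exists_mem_list.comp (Primrec.list_range.comp (Primrec.fst.comp Primrec.snd))
      Primrec.id).of_eq (by simp)
  have hc : Primrec fun q : ℕ × ℕ × ℕ => q.2.2 := Primrec.snd.comp Primrec.snd
  exact Primrec.nat_rec (Primrec.const 0) (Primrec.ite hex hc (Primrec.succ.comp hc)).to₂

theorem exists_card_eq_iff_of_range_eq {f : ℕ → ℕ} {S : Finset ℕ} (k : ℕ)
    (hS : ∀ y, y ∈ Set.range f ↔ y ∈ S) :
    (∃ T : Finset ℕ, T.card = k ∧ ∀ y, (y ∈ Set.range f ↔ y ∈ T)) ↔ S.card = k := by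
  constructor
  · rintro ⟨T, hT, h⟩
    rwa [show S = T from Finset.ext fun y => (hS y).symm.trans (h y)]
  · exact fun h => ⟨S, h, hS⟩

theorem exists_card_eq_iff_valueCount (f : ℕ → ℕ) (k : ℕ) :
    (∃ T : Finset ℕ, T.card = k ∧ ∀ y, (y ∈ Set.range f ↔ y ∈ T)) ↔
      (∃ N, k ≤ valueCount f N) ∧ ∀ N, valueCount f N ≤ k := by
  simp only [valueCount_eq_card]
  constructor
  · rintro ⟨T, rfl, h⟩
    have hsub : ∀ N, (Finset.range N).image f ⊆ T := fun N y hy => by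
      obtain ⟨i, -, rfl⟩ := Finset.mem_image.1 hy
      exact (h _).1 ⟨i, rfl⟩
    refine ⟨?_, fun N => Finset.card_le_card (hsub N)⟩
    choose g hg using fun y : T => (h y).2 y.2
    refine ⟨T.attach.sup g + 1, Finset.card_le_card fun y hy => ?_⟩
    refine Finset.mem_image.2 ⟨g ⟨y, hy⟩, ?_, hg ⟨y, hy⟩⟩
    exact Finset.mem_range.2 (Nat.lt_succ_of_le (Finset.le_sup (Finset.mem_attach T ⟨y, hy⟩)))
  · rintro ⟨⟨N, hN⟩, hle⟩
    refine ⟨(Finset.range N).image f, le_antisymm (hle N) hN, fun y => ⟨?_, ?_⟩⟩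
    · rintro ⟨x, rfl⟩
      have hsub : (Finset.range N).image f ⊆ (Finset.range (max N (x + 1))).image f :=
        Finset.image_subset_image (Finset.range_mono (le_max_left _ _))
      rw [Finset.eq_of_subset_of_card_le hsub ((hle _).trans hN)]
      exact Finset.mem_image_of_mem f (Finset.mem_range.2 (by omega))
    · intro hy
      obtain ⟨i, -, rfl⟩ := Finset.mem_image.1 hy
      exact ⟨i, rfl⟩

theorem computable_decide_valueCount {F : ℕ → ℕ → ℕ} (hF : Primrec₂ F) (k : ℕ)
    {a b : ℕ × ℕ × ℕ → ℕ} (ha : Primrec a) (hb : Primrec b) :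
    Computable fun p : ℕ × ℕ × ℕ =>
      decide (k ≤ valueCount (F p.1) (a p) ∧ valueCount (F p.1) (b p) ≤ k) := by
  have hc := primrec_valueCount hF
  have h₁ : PrimrecPred fun p : ℕ × ℕ × ℕ => k ≤ valueCount (F p.1) (a p) :=
    Primrec.nat_le.comp (Primrec.const k) (hc.comp Primrec.fst ha)
  have h₂ : PrimrecPred fun p : ℕ × ℕ × ℕ => valueCount (F p.1) (b p) ≤ k :=
    Primrec.nat_le.comp (hc.comp Primrec.fst hb) (Primrec.const k)
  exact (h₁.and h₂).decide.to_comp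

theorem isSigma2_card_range_eq {F : ℕ → ℕ → ℕ} (hF : Primrec₂ F) (k : ℕ) :
    IsSigma2 fun n => ∃ T : Finset ℕ, T.card = k ∧ ∀ y, (y ∈ Set.range (F n) ↔ y ∈ T) := by
  refine ⟨fun n y z => decide (k ≤ valueCount (F n) y ∧ valueCount (F n) z ≤ k),
    computable_decide_valueCount hF k (Primrec.fst.comp Primrec.snd)
      (Primrec.snd.comp Primrec.snd), fun n => ?_⟩
  simp only [exists_card_eq_iff_valueCount, decide_eq_true_eq]
  exact ⟨fun ⟨⟨y, hy⟩, h⟩ => ⟨y, fun z => ⟨hy, h z⟩⟩,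
    fun ⟨y, h⟩ => ⟨⟨y, (h 0).1⟩, fun z => (h z).2⟩⟩

theorem isPi2_card_range_eq {F : ℕ → ℕ → ℕ} (hF : Primrec₂ F) (k : ℕ) :
    IsPi2 fun n => ∃ T : Finset ℕ, T.card = k ∧ ∀ y, (y ∈ Set.range (F n) ↔ y ∈ T) := by
  refine ⟨fun n y z => decide (k ≤ valueCount (F n) z ∧ valueCount (F n) y ≤ k),
    computable_decide_valueCount hF k (Primrec.snd.comp Primrec.snd)
      (Primrec.fst.comp Primrec.snd), fun n => ?_⟩
  simp only [exists_card_eq_iff_valueCount, decide_eq_true_eq]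
  exact ⟨fun ⟨⟨z, hz⟩, h⟩ y => ⟨z, hz, h y⟩,
    fun h => ⟨(h 0).imp fun _ hz => hz.1, fun y => (h y).elim fun _ hz => hz.2⟩⟩

/-- On an index coding a number `i` and a program `c`, the section has range `{0, …, m + i}` if `c`
does not halt on `0`, and `{0, …, m + i + 1}` if it does. -/
def haltingFamily (m n x : ℕ) : ℕ :=
  if (Code.evaln x (Denumerable.ofNat Code n.unpair.2) 0).isSome then min x (m + n.unpair.1 + 1)
  else min x (m + n.unpair.1)

theorem primrec_haltingFamily (m : ℕ) : Primrec₂ (haltingFamily m) := by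
  have hu : Primrec fun p : ℕ × ℕ => p.1.unpair := Primrec.unpair.comp Primrec.fst
  have hev : Primrec fun p : ℕ × ℕ =>
      (Code.evaln p.2 (Denumerable.ofNat Code p.1.unpair.2) 0).isSome :=
    Primrec.option_isSome.comp (Code.primrec_evaln.comp
      ((Primrec.snd.pair ((Primrec.ofNat Code).comp (Primrec.snd.comp hu))).pair
        (Primrec.const 0)))
  have hj : Primrec fun p : ℕ × ℕ => m + p.1.unpair.1 :=
    Primrec.nat_add.comp (Primrec.const m) (Primrec.fst.comp hu)
  exact Primrec.ite (Primrec.eq.comp hev (Primrec.const true))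
    (Primrec.nat_min.comp Primrec.snd (Primrec.succ.comp hj))
    (Primrec.nat_min.comp Primrec.snd hj)

theorem haltingFamily_card_range_eq_iff_of_dom (m i k : ℕ) {c : Code} (hc : (c.eval 0).Dom) :
    (∃ T : Finset ℕ, T.card = k ∧
      ∀ y, (y ∈ Set.range (haltingFamily m (Nat.pair i (Encodable.encode c))) ↔ y ∈ T)) ↔
      m + i + 2 = k := by
  obtain ⟨s, hs⟩ := Code.evaln_complete.1 (Part.get_mem hc)
  rw [exists_card_eq_iff_of_range_eq (S := Finset.range (m + i + 2)), Finset.card_range]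
  simp only [Set.mem_range, haltingFamily, Nat.unpair_pair, Denumerable.ofNat_encode,
    Finset.mem_range]
  refine fun y => ⟨?_, fun hy => ?_⟩
  · rintro ⟨x, rfl⟩
    split_ifs <;> omega
  · by_cases hym : y ≤ m + i
    · exact ⟨y, by split_ifs <;> omega⟩
    · have hmem := Code.evaln_mono (le_max_left s y) hs
      exact ⟨max s y, by rw [if_pos (Option.isSome_iff_exists.2 ⟨_, hmem⟩)]; omega⟩

theorem haltingFamily_card_range_eq_iff_of_not_dom (m i k : ℕ) {c : Code}
    (hc : ¬(c.eval 0).Dom) :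
    (∃ T : Finset ℕ, T.card = k ∧
      ∀ y, (y ∈ Set.range (haltingFamily m (Nat.pair i (Encodable.encode c))) ↔ y ∈ T)) ↔
      m + i + 1 = k := by
  have hev : ∀ x, ¬(Code.evaln x c 0).isSome := fun x h => by
    obtain ⟨v, hv⟩ := Option.isSome_iff_exists.1 h
    exact hc (Part.dom_iff_mem.2 ⟨v, Code.evaln_sound hv⟩)
  rw [exists_card_eq_iff_of_range_eq (S := Finset.range (m + i + 1)), Finset.card_range]
  simp only [Set.mem_range, haltingFamily, Nat.unpair_pair, Denumerable.ofNat_encode, hev,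
    Finset.mem_range]
  refine fun y => ⟨?_, fun hy => ⟨y, ?_⟩⟩
  · rintro ⟨x, rfl⟩
    simp
  · simpa using Nat.le_of_lt_succ hy

theorem not_rePred_of_reduces_not_dom {p : ℕ → Prop} (i : ℕ)
    (h : ∀ c : Code, p (Nat.pair i (Encodable.encode c)) ↔ ¬(c.eval 0).Dom) : ¬REPred p := by
  intro hp
  have hf : Computable fun c : Code => Nat.pair i (Encodable.encode c) :=
    (Primrec₂.natPair.comp (Primrec.const i) Primrec.encode).to_comp
  have hcomp : REPred fun c : Code => p (Nat.pair i (Encodable.encode c)) :=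
    Partrec.comp (f := fun n => Part.assert (p n) fun _ => Part.some ()) hp hf
  exact ComputablePred.halting_problem_not_re 0 (REPred.of_eq hcomp h)

end CodomainCard

open CodomainCard

theorem codomainK_Delta2_minus_Sigma1_union_Pi1 (k : ℕ) (hk : 2 ≤ k) :
    (∀ F : ℕ → ℕ → ℕ, Primrec₂ F →
      IsSigma2 (fun n => ∃ T : Finset ℕ, T.card = k ∧
        ∀ y, (y ∈ Set.range (F n) ↔ y ∈ T)) ∧
      IsPi2 (fun n => ∃ T : Finset ℕ, T.card = k ∧
        ∀ y, (y ∈ Set.range (F n) ↔ y ∈ T))) ∧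
    (∃ F : ℕ → ℕ → ℕ, Primrec₂ F ∧
      ¬ REPred (fun n => ∃ T : Finset ℕ, T.card = k ∧
        ∀ y, (y ∈ Set.range (F n) ↔ y ∈ T)) ∧
      ¬ REPred (fun n => ¬ ∃ T : Finset ℕ, T.card = k ∧
        ∀ y, (y ∈ Set.range (F n) ↔ y ∈ T))) := by
  refine ⟨fun F hF => ⟨isSigma2_card_range_eq hF k, isPi2_card_range_eq hF k⟩,
    haltingFamily (k - 2), primrec_haltingFamily _, ?_, ?_⟩
  · refine not_rePred_of_reduces_not_dom 1 fun c => ?_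
    by_cases hc : (c.eval 0).Dom
    · rw [haltingFamily_card_range_eq_iff_of_dom _ _ _ hc]
      simp only [hc, not_true, iff_false]
      omega
    · rw [haltingFamily_card_range_eq_iff_of_not_dom _ _ _ hc]
      simp only [hc, not_false_iff, iff_true]
      omega
  · refine not_rePred_of_reduces_not_dom 0 fun c => not_congr ?_
    by_cases hc : (c.eval 0).Dom
    · rw [haltingFamily_card_range_eq_iff_of_dom _ _ _ hc]
      simp only [hc, iff_true]
      omega
    · rw [haltingFamily_card_range_eq_iff_of_not_dom _ _ _ hc]
      simp only [hc, iff_false]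
      omega
end
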